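/- arXiv:2401.14125 — 5 statements merged into one kernel-verified Lean document; each statement's English description precedes it below -/
import Mathlib

section
/- A positive integer N admits at least two distinct ordered pairs (a, b) of nonnegative integers with N = 3^a + 2^b if and only if N ∈ {5, 11, 17, 35, 259}. Explicitly: 5 = 2^2 + 3^0 = 2^1 + 3^1, 11 = 2^3 + 3^1 = 2^1 + 3^2, 17 = 2^4 + 3^0 = 2^3 + 3^2, 35 = 2^5 + 3^1 = 2^3 + 3^3, and 259 = 2^8 + 3^1 = 2^4 + 3^5. -/
/-- Odd square roots modulo `2 ^ (m + 3)` of an integer congruent to `1` modulo `8`. -/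
theorem exists_odd_sq_modEq_two_pow {δ : ℤ} (hδ : (8 : ℤ) ∣ 1 - δ) (m : ℕ) :
    ∃ s : ℤ, Odd s ∧ (2 : ℤ) ^ (m + 3) ∣ s * s - δ := by
  induction m with
  | zero => exact ⟨1, odd_one, by simpa using hδ⟩
  | succ m ih =>
    obtain ⟨s, ⟨j, rfl⟩, k, hk⟩ := ih
    refine ⟨2 * j + 1 + 2 ^ (m + 2) * k, ⟨j + 2 ^ (m + 1) * k, by ring⟩,
      k * (1 + j) + 2 ^ m * k ^ 2, ?_⟩
    linear_combination hk

/-- Square roots modulo powers of `3` of an integer congruent to `1` modulo `3`. -/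
theorem exists_sq_modEq_three_pow {δ : ℤ} (hδ : (3 : ℤ) ∣ 1 - δ) (m : ℕ) :
    ∃ s : ℤ, (3 : ℤ) ∣ s - 1 ∧ (3 : ℤ) ^ (m + 1) ∣ s * s - δ := by
  induction m with
  | zero => exact ⟨1, by simp, by simpa using hδ⟩
  | succ m ih =>
    obtain ⟨s, ⟨j, hj⟩, k, hk⟩ := ih
    obtain rfl : s = 3 * j + 1 := by linarith
    refine ⟨3 * j + 1 + 3 ^ (m + 1) * k, ⟨j + 3 ^ m * k, by ring⟩,
      k * (1 + 2 * j) + 3 ^ m * k ^ 2, ?_⟩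
    linear_combination hk

/-- Evaluation of `z` at a square root `s` of `δ` modulo `m` is multiplicative modulo `m`. -/
theorem Zsqrtd.eval_mul_modEq {δ s m : ℤ} (hs : m ∣ s * s - δ) (z w : ℤ√δ) :
    (z * w).re + (z * w).im * s ≡ (z.re + z.im * s) * (w.re + w.im * s) [ZMOD m] := by
  obtain ⟨k, hk⟩ := hs
  refine Int.modEq_iff_dvd.2 ⟨k * (z.im * w.im), ?_⟩
  simp only [Zsqrtd.re_mul, Zsqrtd.im_mul]
  linear_combination (z.im * w.im) * hk

theorem Zsqrtd.eval_pow_modEq {δ s m : ℤ} (hs : m ∣ s * s - δ) (z : ℤ√δ) (n : ℕ) :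
    (z ^ n).re + (z ^ n).im * s ≡ (z.re + z.im * s) ^ n [ZMOD m] := by
  induction n with
  | zero => simp
  | succ n ih =>
    rw [pow_succ, pow_succ]
    exact (Zsqrtd.eval_mul_modEq hs _ _).trans (ih.mul_right _)

theorem Zsqrtd.dvd_eval_pow_mul_pow {δ s m x y : ℤ} {z w : ℤ√δ} {i j : ℕ}
    (hs : m ∣ s * s - δ) (hz : x ∣ z.re + z.im * s) (hw : y ∣ w.re + w.im * s)
    (hm : x ^ i * y ^ j ∣ m) :
    x ^ i * y ^ j ∣ (z ^ i * w ^ j).re + (z ^ i * w ^ j).im * s := by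
  have h := (Zsqrtd.eval_mul_modEq hs (z ^ i) (w ^ j)).trans
    ((Zsqrtd.eval_pow_modEq hs z i).mul (Zsqrtd.eval_pow_modEq hs w j))
  exact (h.of_dvd hm).dvd_iff.2 (mul_dvd_mul (pow_dvd_pow_of_dvd hz i) (pow_dvd_pow_of_dvd hw j))

theorem Zsqrtd.dvd_two_mul_im {δ s c : ℤ} {z : ℤ√δ} (hs : IsCoprime c s)
    (h₁ : c ∣ z.re + z.im * s) (h₂ : c ∣ z.re + z.im * -s) : c ∣ 2 * z.im := by
  refine hs.dvd_of_dvd_mul_right ?_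
  have := dvd_sub h₁ h₂
  ring_nf at this ⊢
  exact this

theorem Zsqrtd.norm_eq {δ : ℤ} (z : ℤ√δ) : z.norm = z.re ^ 2 - δ * z.im ^ 2 := by
  rw [Zsqrtd.norm_def]; ring

theorem Zsqrtd.norm_pow {δ : ℤ} (z : ℤ√δ) (n : ℕ) : (z ^ n).norm = z.norm ^ n :=
  map_pow Zsqrtd.normMonoidHom z n

/-- The real and imaginary parts of a power, when `√δ * z.im` is small modulo `m`. -/
theorem Zsqrtd.pow_modEq {δ m : ℤ} (z : ℤ√δ) (h : m ∣ δ * z.im ^ 2) (n : ℕ) :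
    (z ^ n).re ≡ z.re ^ n [ZMOD m] ∧
      ∃ r, (z ^ n).im = z.im * r ∧ r * z.re ≡ n * z.re ^ n [ZMOD m] := by
  induction n with
  | zero => exact ⟨by simp [Int.ModEq.refl], 0, by simp, by simp [Int.ModEq.refl]⟩
  | succ n ih =>
    obtain ⟨h₁, r, hr, h₂⟩ := ih
    obtain ⟨k, hk⟩ := h
    rw [Int.modEq_iff_dvd] at h₁ h₂
    obtain ⟨k₁, h₁⟩ := h₁
    obtain ⟨k₂, h₂⟩ := h₂
    refine ⟨Int.modEq_iff_dvd.2 ⟨k₁ * z.re - k * r, ?_⟩, (z ^ n).re + r * z.re, ?_,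
      Int.modEq_iff_dvd.2 ⟨k₁ * z.re + k₂ * z.re, ?_⟩⟩
    · rw [pow_succ z, Zsqrtd.re_mul, hr]
      linear_combination z.re * h₁ - r * hk
    · rw [pow_succ z, Zsqrtd.im_mul, hr]; ring
    · push_cast
      linear_combination z.re * h₁ + z.re * h₂

theorem Zsqrtd.not_dvd_re_pow {δ p : ℤ} (hp : Prime p) {z : ℤ√δ} (h : p ∣ δ * z.im ^ 2)
    (hz : ¬ p ∣ z.re) (n : ℕ) : ¬ p ∣ (z ^ n).re := by
  rw [(z.pow_modEq h n).1.dvd_iff]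
  exact fun h' => hz (hp.dvd_of_dvd_pow h')

theorem Zsqrtd.im_dvd_im_pow {δ : ℤ} (z : ℤ√δ) (n : ℕ) : z.im ∣ (z ^ n).im := by
  obtain ⟨-, r, hr, -⟩ := z.pow_modEq (m := 1) (one_dvd _) n
  exact ⟨r, hr⟩

theorem Zsqrtd.exists_im_pow_eq {δ p : ℤ} (hp : Prime p) {z : ℤ√δ} (h : p ∣ δ * z.im ^ 2)
    (hz : ¬ p ∣ z.re) {n : ℕ} (hn : ¬ p ∣ (n : ℤ)) : ∃ r, (z ^ n).im = z.im * r ∧ ¬ p ∣ r := by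
  obtain ⟨-, r, hr, h'⟩ := z.pow_modEq h n
  refine ⟨r, hr, fun hd => ?_⟩
  have := h'.dvd_iff.1 (hd.mul_right _)
  exact (hp.dvd_or_dvd this).elim hn fun h => hz (hp.dvd_of_dvd_pow h)

/-- If `z ^ i * star w ^ j` is an integer, then every power of `p` dividing the imaginary part of
`w` divides that of `z ^ i`. -/
theorem Zsqrtd.pow_dvd_im_pow {δ p : ℤ} (hp : Prime p) {z w : ℤ√δ} {i j k : ℕ}
    (h : (z ^ i * star w ^ j).im = 0) (hw : p ∣ δ * w.im ^ 2) (hw' : ¬ p ∣ w.re)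
    (hk : p ^ k ∣ w.im) : p ^ k ∣ (z ^ i).im := by
  rw [← star_pow, Zsqrtd.im_mul, Zsqrtd.re_star, Zsqrtd.im_star] at h
  have h₁ : p ^ k ∣ (z ^ i).im * (w ^ j).re := by
    rw [show (z ^ i).im * (w ^ j).re = (z ^ i).re * (w ^ j).im by linarith]
    exact (hk.trans (w.im_dvd_im_pow j)).mul_left _
  exact hp.pow_dvd_of_dvd_mul_right k (Zsqrtd.not_dvd_re_pow hp hw hw' j) h₁

theorem Zsqrtd.exists_im_pow_two_pow {δ : ℤ} (z : ℤ√δ) (hz : ¬ 2 ∣ z.re) (hi : 2 ∣ z.im) (k : ℕ) :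
    ∃ r, (z ^ 2 ^ k).im = z.im * 2 ^ k * r ∧ ¬ 2 ∣ r := by
  induction k with
  | zero => exact ⟨1, by simp, by norm_num⟩
  | succ k ih =>
    obtain ⟨r, hr, h⟩ := ih
    have h₂ := Zsqrtd.not_dvd_re_pow Int.prime_two (z := z)
      ((dvd_pow hi two_ne_zero).mul_left _) hz (2 ^ k)
    refine ⟨r * (z ^ 2 ^ k).re, ?_, Int.prime_two.not_dvd_mul h h₂⟩
    rw [pow_succ 2 k, pow_mul, sq (z ^ 2 ^ k), Zsqrtd.im_mul, hr]
    ring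

theorem Zsqrtd.two_pow_dvd_of_dvd_im_pow {δ : ℤ} {z : ℤ√δ} (hz : ¬ 2 ∣ z.re) (hi : 2 ∣ z.im)
    (h0 : z.im ≠ 0) {n t : ℕ} (hn : n ≠ 0) (h : z.im * 2 ^ t ∣ (z ^ n).im) : 2 ^ t ∣ (n : ℤ) := by
  obtain ⟨k, m, hm, rfl⟩ := Nat.exists_eq_pow_mul_and_not_dvd hn 2 (by norm_num)
  have hd : (2 : ℤ) ∣ δ * z.im ^ 2 := (dvd_pow hi two_ne_zero).mul_left _
  obtain ⟨r, hr, hr'⟩ := z.exists_im_pow_two_pow hz hi k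
  obtain ⟨r₂, hr₂, hr₂'⟩ := Zsqrtd.exists_im_pow_eq Int.prime_two (z := z ^ 2 ^ k)
    (by rw [hr]; exact (dvd_pow ((hi.mul_right _).mul_right _) two_ne_zero).mul_left _)
    (Zsqrtd.not_dvd_re_pow Int.prime_two hd hz _) (n := m) (by exact_mod_cast hm)
  rw [pow_mul, hr₂, hr, mul_assoc, mul_assoc] at h
  have := Int.dvd_of_mul_dvd_mul_left h0 h
  rw [← mul_assoc] at this
  have := Int.prime_two.pow_dvd_of_dvd_mul_right _ hr₂' this
  have := Int.prime_two.pow_dvd_of_dvd_mul_right _ hr' this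
  push_cast
  exact this.mul_right _

theorem Zsqrtd.exists_im_pow_three_pow {δ H : ℤ} (z : ℤ√δ) (hz : ¬ 3 ∣ z.re)
    (hH : δ * z.im ^ 2 = -3 * H) (k : ℕ) :
    ∃ r, (z ^ 3 ^ (k + 1)).im = z.im * 3 ^ (k + 1) * (z.re ^ 2 - H) * r ∧ ¬ 3 ∣ r := by
  have hcube (w : ℤ√δ) : (w ^ 3).im = w.im * (3 * w.re ^ 2 + δ * w.im ^ 2) := by
    rw [pow_succ, sq, Zsqrtd.im_mul, Zsqrtd.re_mul, Zsqrtd.im_mul]; ring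
  induction k with
  | zero =>
    refine ⟨1, ?_, by norm_num⟩
    rw [zero_add, pow_one, hcube, hH]; ring
  | succ k ih =>
    obtain ⟨r, hr, h⟩ := ih
    have h₂ := Zsqrtd.not_dvd_re_pow Int.prime_three (z := z)
      (by rw [hH]; exact ⟨-H, by ring⟩) hz (3 ^ (k + 1))
    set w := z ^ 3 ^ (k + 1) with hw
    refine ⟨r * (w.re ^ 2 - 3 * (3 * H * (3 ^ k * (z.re ^ 2 - H) * r) ^ 2)), ?_,
      Int.prime_three.not_dvd_mul h fun h₃ => ?_⟩
    · rw [pow_succ 3 (k + 1), pow_mul, hcube, ← hw, hr]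
      linear_combination (z.im * 3 ^ (k + 1) * (z.re ^ 2 - H) * r) *
        (3 ^ (k + 1) * (z.re ^ 2 - H) * r) ^ 2 * hH
    · exact h₂ (Int.prime_three.dvd_of_dvd_pow ((dvd_sub_left (dvd_mul_right _ _)).1 h₃))

theorem Zsqrtd.three_pow_dvd_of_dvd_im_pow {δ H : ℤ} {z : ℤ√δ} (hz : ¬ 3 ∣ z.re)
    (hH : δ * z.im ^ 2 = -3 * H) (h0 : z.im ≠ 0) {n t : ℕ} (hn : n ≠ 0)
    (h : z.im * 3 ^ t ∣ (z ^ n).im) : 3 ^ t ∣ (n : ℤ) * (z.re ^ 2 - H) := by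
  obtain ⟨k, m, hm, rfl⟩ := Nat.exists_eq_pow_mul_and_not_dvd hn 3 (by norm_num)
  have hd : (3 : ℤ) ∣ δ * z.im ^ 2 := by rw [hH]; exact ⟨-H, by ring⟩
  obtain ⟨r₂, hr₂, hr₂'⟩ := Zsqrtd.exists_im_pow_eq Int.prime_three (z := z ^ 3 ^ k)
    (by
      obtain ⟨r, hr⟩ := z.im_dvd_im_pow (3 ^ k)
      rw [hr, mul_pow, ← mul_assoc]; exact hd.mul_right _)
    (Zsqrtd.not_dvd_re_pow Int.prime_three hd hz _) (n := m) (by exact_mod_cast hm)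
  rw [pow_mul, hr₂] at h
  cases k with
  | zero =>
    rw [pow_zero, pow_one] at h
    have := Int.prime_three.pow_dvd_of_dvd_mul_right (a := 1) _ hr₂'
      (by simpa using Int.dvd_of_mul_dvd_mul_left h0 h)
    exact this.trans (one_dvd _)
  | succ k =>
    obtain ⟨r, hr, hr'⟩ := z.exists_im_pow_three_pow hz hH k
    rw [hr, mul_assoc, mul_assoc, mul_assoc] at h
    have := Int.dvd_of_mul_dvd_mul_left h0 h
    rw [← mul_assoc, ← mul_assoc] at this
    have := Int.prime_three.pow_dvd_of_dvd_mul_right _ hr₂' this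
    have := Int.prime_three.pow_dvd_of_dvd_mul_right _ hr' this
    push_cast
    rw [mul_right_comm]
    exact this.mul_right _

/-- If `z` and `w` split compatibly under evaluation at a square root of `δ` modulo `m`, then
`z ^ i * star w ^ j` is, up to a small factor, divisible by the square root of its norm. -/
theorem Zsqrtd.exists_two_mul_im_eq {δ s m C x x' y y' : ℤ} {z w : ℤ√δ} {i j : ℕ}
    (hs : m ∣ s * s - δ) (hC : C ∣ m) (hsC : IsCoprime C s)
    (hx : x ∣ z.re + z.im * s) (hx' : x' ∣ z.re + z.im * -s)
    (hy : y ∣ w.re + w.im * s) (hy' : y' ∣ w.re + w.im * -s)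
    (hz : z.norm = x * x') (hw : w.norm = y * y')
    (h₁ : x ^ i * y' ^ j = C) (h₂ : x' ^ i * y ^ j = C) :
    ∃ k, 2 * (z ^ i * star w ^ j).im = C * k ∧
      4 * (z ^ i * star w ^ j).re ^ 2 = (4 + δ * k ^ 2) * C ^ 2 := by
  have e₁ := Zsqrtd.dvd_eval_pow_mul_pow (w := star w) (i := i) (j := j) hs hx
    (by simpa using hy') (h₁.symm ▸ hC)
  have e₂ := Zsqrtd.dvd_eval_pow_mul_pow (s := -s) (w := star w) (i := i) (j := j)
    (by simpa using hs) hx' (by simpa using hy) (h₂.symm ▸ hC)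
  rw [h₁] at e₁
  rw [h₂] at e₂
  obtain ⟨k, hk⟩ := Zsqrtd.dvd_two_mul_im hsC e₁ e₂
  have hn : (z ^ i * star w ^ j).norm = C ^ 2 := by
    rw [Zsqrtd.norm_mul, Zsqrtd.norm_pow, Zsqrtd.norm_pow, Zsqrtd.norm_conj, hz, hw, sq]
    nth_rewrite 1 [← h₁]
    rw [← h₂]
    ring
  rw [Zsqrtd.norm_eq] at hn
  refine ⟨k, hk, ?_⟩
  linear_combination 4 * hn + δ * (2 * (z ^ i * star w ^ j).im + C * k) * hk

theorem exists_sign_pow_dvd {p P Q s : ℤ} {k : ℕ} (hp : Prime p) (hP : ¬ p ∣ 2 * P)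
    (h : p ^ k ∣ P ^ 2 - (Q * s) ^ 2) : ∃ q, q ^ 2 = Q ^ 2 ∧ p ^ k ∣ P + q * s := by
  rw [show P ^ 2 - (Q * s) ^ 2 = (P + Q * s) * (P + -Q * s) by ring] at h
  by_cases h' : p ∣ P + -Q * s
  · refine ⟨-Q, by ring, hp.pow_dvd_of_dvd_mul_left k (fun h₂ => hP ?_) h⟩
    exact (dvd_add h₂ h').trans (dvd_of_eq (by ring))
  · exact ⟨Q, rfl, hp.pow_dvd_of_dvd_mul_right k h' h⟩

theorem exists_sign_two_pow_dvd {P Q s : ℤ} {k : ℕ} (hP : Odd P) (hQ : Odd (Q * s))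
    (h : 2 ^ (k + 2) ∣ P ^ 2 - (Q * s) ^ 2) :
    ∃ q, q ^ 2 = Q ^ 2 ∧ 2 ∣ P + q * s ∧ 2 ^ (k + 1) ∣ P + q * -s := by
  obtain ⟨u, hu⟩ := (hP.add_odd hQ).two_dvd
  obtain ⟨v, hv⟩ := (hP.sub_odd hQ).two_dvd
  have huv : P = u + v := by linarith
  have h' : (2 : ℤ) ^ k ∣ u * v := by
    rw [show P ^ 2 - (Q * s) ^ 2 = (P + Q * s) * (P - Q * s) by ring, hu, hv, pow_add] at h
    refine Int.dvd_of_mul_dvd_mul_left (a := 2 ^ 2) (by norm_num) ?_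
    rwa [mul_comm, show (2 : ℤ) ^ 2 * (u * v) = 2 * u * (2 * v) by ring]
  by_cases hd : (2 : ℤ) ∣ u
  · have hd' : ¬ (2 : ℤ) ∣ v := fun h₂ => by
      have := dvd_add hd h₂
      rw [← huv] at this
      exact Int.not_even_iff_odd.2 hP (even_iff_two_dvd.2 this)
    obtain ⟨l, hl⟩ := Int.prime_two.pow_dvd_of_dvd_mul_right k hd' h'
    exact ⟨-Q, by ring, ⟨v, by linarith⟩, ⟨l, by rw [hl] at hu; linear_combination hu⟩⟩
  · obtain ⟨l, hl⟩ := Int.prime_two.pow_dvd_of_dvd_mul_left k hd h'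
    exact ⟨Q, rfl, ⟨u, hu⟩, ⟨l, by rw [hl] at hv; linear_combination hv⟩⟩

theorem two_pow_dvd_of_pow_add_pow_eq {a c d t : ℕ}
    (h : (3 : ℤ) ^ a + 2 ^ (d + 2 * t) = 3 ^ c + 2 ^ d)
    (hlt : (2 : ℤ) ^ d < 3 ^ a) (ha : a ≠ 0) (hc : c ≠ 0) : 2 ^ t ∣ (c : ℤ) := by
  have h3 (n : ℕ) : ¬ (3 : ℤ) ∣ 2 ^ n := fun h' =>
    absurd (Int.prime_three.dvd_of_dvd_pow h') (by norm_num)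
  have h2 (n : ℕ) : ¬ (2 : ℤ) ∣ 3 ^ n := fun h' =>
    absurd (Int.prime_two.dvd_of_dvd_pow h') (by norm_num)
  set δ : ℤ := 2 ^ d * (2 ^ d - 3 ^ a) with hδ
  have hδneg : δ < 0 := mul_neg_of_pos_of_neg (by positivity) (by linarith)
  have hδ3 : (3 : ℤ) ∣ 1 - δ := by
    have h4 : (3 : ℤ) ∣ 1 - 4 ^ d := by simpa using sub_dvd_pow_sub_pow (1 : ℤ) 4 d
    have : 1 - δ = 1 - 4 ^ d + 2 ^ d * 3 ^ a := by
      rw [hδ, show (4 : ℤ) = 2 * 2 by norm_num, mul_pow]; ring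
    rw [this]
    exact dvd_add h4 ((dvd_pow_self 3 ha).mul_left _)
  obtain ⟨s, hs1, hs⟩ := exists_sq_modEq_three_pow hδ3 (2 * a * c)
  have hs3 : ¬ (3 : ℤ) ∣ s := by omega
  have hN₁ : (2 ^ (d + 1) - 3 ^ a : ℤ) ^ 2 - δ * 2 ^ 2 = 3 ^ (2 * a) := by rw [hδ]; ring
  have hN₂ : (2 ^ (d + 2 * t + 1) - 3 ^ c : ℤ) ^ 2 - δ * (2 ^ (t + 1)) ^ 2 = 3 ^ (2 * c) := by
    rw [hδ, show (2 : ℤ) ^ d - 3 ^ a = 2 ^ (d + 2 * t) - 3 ^ c by linarith]; ring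
  have hsign (n k Q b : ℕ) (hn : n ≠ 0) (hk : k ≤ 2 * a * c + 1)
      (hN : (2 ^ (b + 1) - 3 ^ n : ℤ) ^ 2 - δ * Q ^ 2 = 3 ^ k) :
      ∃ q : ℤ, q ^ 2 = Q ^ 2 ∧ 3 ^ k ∣ (2 ^ (b + 1) - 3 ^ n : ℤ) + q * s := by
    refine exists_sign_pow_dvd Int.prime_three (fun h' => ?_) ?_
    · refine h3 (b + 2) ?_
      exact (dvd_add h' ((dvd_pow_self (3 : ℤ) hn).mul_left 2)).trans (dvd_of_eq (by ring))
    · refine (dvd_sub (dvd_refl ((3 : ℤ) ^ k))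
        (((pow_dvd_pow 3 hk).trans hs).mul_left (Q ^ 2))).trans (dvd_of_eq ?_)
      linear_combination -hN
  obtain ⟨q₁, hq₁, hd₁⟩ := hsign a (2 * a) 2 d ha
    (by nlinarith [Nat.pos_of_ne_zero ha, Nat.pos_of_ne_zero hc]) (by exact_mod_cast hN₁)
  obtain ⟨q₂, hq₂, hd₂⟩ := hsign c (2 * c) (2 ^ (t + 1)) (d + 2 * t) hc
    (by nlinarith [Nat.pos_of_ne_zero ha, Nat.pos_of_ne_zero hc]) (by exact_mod_cast hN₂)
  simp only [Nat.cast_ofNat, Nat.cast_pow] at hq₁ hq₂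
  have hq₁' : q₁ ∣ 2 ∧ 2 ∣ q₁ := by
    rcases sq_eq_sq_iff_eq_or_eq_neg.1 hq₁ with rfl | rfl <;> norm_num
  have hq₂' : 2 ^ (t + 1) ∣ q₂ := by
    rcases sq_eq_sq_iff_eq_or_eq_neg.1 hq₂ with rfl | rfl <;> simp
  have hq₂'' : 2 ∣ q₂ := (dvd_pow_self 2 (by omega)).trans hq₂'
  set z : ℤ√δ := ⟨2 ^ (d + 1) - 3 ^ a, q₁⟩ with hz
  set w : ℤ√δ := ⟨2 ^ (d + 2 * t + 1) - 3 ^ c, q₂⟩ with hw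
  have hz2 : ¬ 2 ∣ z.re := fun h' =>
    h2 a ((dvd_sub_right (dvd_pow_self 2 (by omega))).1 h')
  have hw2 : ¬ 2 ∣ w.re := fun h' =>
    h2 c ((dvd_sub_right (dvd_pow_self 2 (by omega))).1 h')
  have hzd : (2 : ℤ) ∣ δ * z.im ^ 2 := (dvd_pow hq₁'.2 two_ne_zero).mul_left _
  have hwd : (2 : ℤ) ∣ δ * w.im ^ 2 := (dvd_pow hq₂'' two_ne_zero).mul_left _
  obtain ⟨k, hk₁, hk₂⟩ := Zsqrtd.exists_two_mul_im_eq (z := z) (w := w) (i := c) (j := a)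
    (C := 3 ^ (2 * a * c)) (x' := 1) (y' := 1) hs (pow_dvd_pow 3 (by omega))
    ((Int.prime_three.coprime_iff_not_dvd.2 hs3).pow_left) hd₁ (one_dvd _) hd₂ (one_dvd _)
    (by rw [Zsqrtd.norm_eq]; linear_combination hN₁ - δ * hq₁)
    (by rw [Zsqrtd.norm_eq]; linear_combination hN₂ - δ * hq₂)
    (by rw [one_pow, mul_one, ← pow_mul]) (by rw [one_pow, one_mul, ← pow_mul]; ring)
  have hre : (z ^ c * star w ^ a).re ≠ 0 := by
    intro h0
    rw [← star_pow, Zsqrtd.re_mul, Zsqrtd.re_star, Zsqrtd.im_star] at h0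
    have h₁ : (2 : ℤ) ∣ δ * (z ^ c).im * -(w ^ a).im :=
      ((hq₁'.2.trans (z.im_dvd_im_pow c)).mul_left _).mul_right _
    have h₂ : (2 : ℤ) ∣ (z ^ c).re * (w ^ a).re := (dvd_add_left h₁).1 (h0 ▸ dvd_zero 2)
    exact Int.prime_two.not_dvd_mul (Zsqrtd.not_dvd_re_pow Int.prime_two hzd hz2 c)
      (Zsqrtd.not_dvd_re_pow Int.prime_two hwd hw2 a) h₂
  have hk0 : k = 0 := by
    obtain ⟨l, rfl⟩ : (2 : ℤ) ∣ k :=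
      (Int.prime_two.dvd_or_dvd (hk₁ ▸ dvd_mul_right 2 _)).resolve_left (h2 _)
    have hpos : 0 < (4 + δ * (2 * l) ^ 2) * (3 ^ (2 * a * c)) ^ 2 := hk₂ ▸ by positivity
    have hpos := pos_of_mul_pos_left hpos (by positivity)
    by_contra hl
    have : 0 < l ^ 2 := by
      have : l ≠ 0 := by rintro rfl; simp at hl
      positivity
    nlinarith
  have him : (z ^ c * star w ^ a).im = 0 := by simpa [hk0] using hk₁
  have := Zsqrtd.pow_dvd_im_pow Int.prime_two him hwd hw2 hq₂'
  refine Zsqrtd.two_pow_dvd_of_dvd_im_pow hz2 hq₁'.2 (fun h0 => ?_) hc (t := t) ?_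
  · rw [show q₁ = 0 from h0] at hq₁; norm_num at hq₁
  · exact (mul_dvd_mul_right hq₁'.1 _).trans (by rwa [← pow_succ'])

theorem three_pow_dvd_of_pow_add_pow_eq {a m n t : ℕ}
    (h : (3 : ℤ) ^ (a + 1) + 2 ^ (n + 2) = 3 ^ (a + 1 + 2 * t) + 2 ^ (m + 2))
    (hlt : (3 : ℤ) ^ (a + 1) < 2 ^ (m + 2)) (hm : m ≠ 0) (hn : n ≠ 0) :
    3 ^ t ∣ (n : ℤ) * (3 ^ a * (3 ^ (a + 1) - 2 ^ (m + 2)) + 4 ^ m) := by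
  have h3 (n : ℕ) : ¬ (3 : ℤ) ∣ 2 ^ n := fun h' =>
    absurd (Int.prime_three.dvd_of_dvd_pow h') (by norm_num)
  set δ : ℤ := 3 ^ (a + 1) * (3 ^ (a + 1) - 2 ^ (m + 2)) with hδ
  have hδ8 : (8 : ℤ) ∣ 1 - δ := by
    obtain ⟨m, rfl⟩ := Nat.exists_eq_add_one_of_ne_zero hm
    have h9 : (8 : ℤ) ∣ 1 - 9 ^ (a + 1) := by
      simpa using (show (8 : ℤ) ∣ 1 - 9 by norm_num).trans (sub_dvd_pow_sub_pow (1 : ℤ) 9 (a + 1))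
    have : 1 - δ = 1 - 9 ^ (a + 1) + 8 * (3 ^ (a + 1) * 2 ^ m) := by
      rw [hδ, show (9 : ℤ) = 3 * 3 by norm_num, mul_pow]; ring
    rw [this]
    exact dvd_add h9 (dvd_mul_right _ _)
  have hδneg : δ < 0 := mul_neg_of_pos_of_neg (by positivity) (by linarith)
  have hδneg : δ ≤ -7 := by omega
  obtain ⟨s, hs1, hs⟩ := exists_odd_sq_modEq_two_pow hδ8 ((2 * m + 1) * n + m)
  have hN₁ : (3 ^ (a + 1) - 2 ^ (m + 1) : ℤ) ^ 2 - δ * 1 ^ 2 = 2 ^ (2 * m + 2) := by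
    rw [hδ]; ring
  have hN₂ : (3 ^ (a + 1 + 2 * t) - 2 ^ (n + 1) : ℤ) ^ 2 - δ * (3 ^ t) ^ 2 = 2 ^ (2 * n + 2) := by
    rw [hδ, show (3 : ℤ) ^ (a + 1) - 2 ^ (m + 2) = 3 ^ (a + 1 + 2 * t) - 2 ^ (n + 2) by linarith]
    ring
  have hsign (c k Q b : ℕ) (hQ : Odd (Q : ℤ)) (hk : k + 2 ≤ (2 * m + 1) * n + m + 3)
      (hN : (3 ^ c - 2 ^ (b + 1) : ℤ) ^ 2 - δ * Q ^ 2 = 2 ^ (k + 2)) :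
      ∃ q : ℤ, q ^ 2 = Q ^ 2 ∧ 2 ∣ (3 ^ c - 2 ^ (b + 1) : ℤ) + q * s ∧
        2 ^ (k + 1) ∣ (3 ^ c - 2 ^ (b + 1) : ℤ) + q * -s := by
    refine exists_sign_two_pow_dvd ?_ (hQ.mul hs1) ?_
    · exact (Odd.pow (by decide)).sub_even (even_two.pow_of_ne_zero (by omega))
    · refine (dvd_sub (dvd_refl ((2 : ℤ) ^ (k + 2)))
        (((pow_dvd_pow 2 hk).trans hs).mul_left (Q ^ 2))).trans (dvd_of_eq ?_)
      linear_combination -hN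
  obtain ⟨q₁, hq₁, hd₁, hd₁'⟩ := hsign (a + 1) (2 * m) 1 m (by norm_num)
    (by nlinarith [Nat.pos_of_ne_zero hm, Nat.pos_of_ne_zero hn]) (by exact_mod_cast hN₁)
  obtain ⟨q₂, hq₂, hd₂, hd₂'⟩ := hsign (a + 1 + 2 * t) (2 * n) (3 ^ t) n
    (by push_cast; exact Odd.pow (by decide))
    (by nlinarith [Nat.pos_of_ne_zero hm, Nat.pos_of_ne_zero hn]) (by exact_mod_cast hN₂)
  simp only [Nat.cast_one, Nat.cast_ofNat, Nat.cast_pow] at hq₁ hq₂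
  have hq₂' : 3 ^ t ∣ q₂ := by
    rcases sq_eq_sq_iff_eq_or_eq_neg.1 hq₂ with rfl | rfl <;> simp
  set z : ℤ√δ := ⟨3 ^ (a + 1) - 2 ^ (m + 1), q₁⟩ with hz
  set w : ℤ√δ := ⟨3 ^ (a + 1 + 2 * t) - 2 ^ (n + 1), q₂⟩ with hw
  have hz3 : ¬ 3 ∣ z.re := fun h' =>
    h3 _ ((dvd_sub_right (dvd_pow_self 3 (by omega))).1 h')
  have hw3 : ¬ 3 ∣ w.re := fun h' =>
    h3 _ ((dvd_sub_right (dvd_pow_self 3 (by omega))).1 h')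
  have hwd : (3 : ℤ) ∣ δ * w.im ^ 2 :=
    ((dvd_pow_self 3 (by omega)).mul_right _).mul_right _
  obtain ⟨k, hk₁, hk₂⟩ := Zsqrtd.exists_two_mul_im_eq (z := z) (w := w) (i := n) (j := m)
    (C := 2 ^ ((2 * m + 1) * n + m)) hs (pow_dvd_pow 2 (by omega))
    ((Int.prime_two.coprime_iff_not_dvd.2 (by
      rw [← even_iff_two_dvd]; exact Int.not_even_iff_odd.2 hs1)).pow_left) hd₁ hd₁' hd₂ hd₂'
    (by rw [Zsqrtd.norm_eq]; linear_combination hN₁ - δ * hq₁)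
    (by rw [Zsqrtd.norm_eq]; linear_combination hN₂ - δ * hq₂)
    (by ring) (by ring)
  have hk0 : k = 0 := by
    have hpos : 0 ≤ (4 + δ * k ^ 2) * (2 ^ ((2 * m + 1) * n + m)) ^ 2 := hk₂ ▸ by positivity
    have hpos := nonneg_of_mul_nonneg_left hpos (by positivity)
    by_contra hl
    have : 0 < k ^ 2 := by positivity
    nlinarith
  have him : (z ^ n * star w ^ m).im = 0 := by simpa [hk0] using hk₁
  have hdvd := Zsqrtd.pow_dvd_im_pow Int.prime_three him hwd hw3 hq₂'
  have hq₁' : q₁ ∣ 1 := by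
    rcases sq_eq_sq_iff_eq_or_eq_neg.1 hq₁ with rfl | rfl <;> norm_num
  have := Zsqrtd.three_pow_dvd_of_dvd_im_pow (H := 3 ^ a * (2 ^ (m + 2) - 3 ^ (a + 1))) hz3
    (by linear_combination δ * hq₁) (fun h0 => by rw [show q₁ = 0 from h0] at hq₁; norm_num at hq₁)
    hn (t := t) (by simpa using (mul_dvd_mul_right hq₁' (3 ^ t)).trans (by simpa using hdvd))
  have h4 : ¬ (3 : ℤ) ∣ 4 := by norm_num
  refine Int.prime_three.pow_dvd_of_dvd_mul_right t h4 ?_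
  refine this.trans (dvd_of_eq ?_)
  rw [show (4 : ℤ) ^ m = 2 ^ m * 2 ^ m by rw [← mul_pow]; norm_num]
  ring

theorem three_pow_le_of_dvd {a t : ℕ} (ht : t ≠ 0) (h : 3 ^ a ∣ 4 ^ t - 1) : 3 ^ a ≤ 3 * t := by
  have hv := padicValNat.pow_sub_pow (p := 3) (x := 4) (y := 1) (by norm_num) (by norm_num)
    (by norm_num) (by norm_num) ht
  rw [one_pow, show 4 - 1 = 3 from rfl, padicValNat.self (by norm_num)] at hv
  have h0 : 4 ^ t - 1 ≠ 0 := Nat.sub_ne_zero_of_lt (Nat.one_lt_pow ht (by norm_num))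
  rw [padicValNat_dvd_iff_le h0, hv] at h
  calc 3 ^ a ≤ 3 ^ (1 + padicValNat 3 t) := Nat.pow_le_pow_right (by norm_num) h
    _ = 3 * 3 ^ padicValNat 3 t := by rw [pow_add, pow_one]
    _ ≤ 3 * t := Nat.mul_le_mul_left _ (Nat.le_of_dvd (by omega) pow_padicValNat_dvd)

theorem two_pow_le_of_dvd {d t : ℕ} (ht : t ≠ 0) (h : 2 ^ d ∣ 9 ^ t - 1) : 2 ^ d ≤ 8 * t := by
  have hv := padicValNat.pow_two_sub_pow (x := 3) (y := 1) (n := 2 * t) (by norm_num) (by norm_num)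
    (by norm_num) (by omega) (even_two_mul t)
  rw [one_pow, pow_mul, show 3 ^ 2 = 9 from rfl, show 3 - 1 = 2 from rfl,
    show 3 + 1 = 2 ^ 2 from rfl, padicValNat.self (by norm_num), padicValNat.prime_pow] at hv
  have h0 : 9 ^ t - 1 ≠ 0 := Nat.sub_ne_zero_of_lt (Nat.one_lt_pow ht (by norm_num))
  rw [padicValNat_dvd_iff_le h0] at h
  calc 2 ^ d ≤ 2 ^ (2 + padicValNat 2 (2 * t)) := Nat.pow_le_pow_right (by norm_num) (by omega)
    _ = 4 * 2 ^ padicValNat 2 (2 * t) := by rw [pow_add]; norm_num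
    _ ≤ 4 * (2 * t) := Nat.mul_le_mul_left _ (Nat.le_of_dvd (by omega) pow_padicValNat_dvd)
    _ = 8 * t := by ring

theorem eq_eleven_of_two_pow_lt_three_pow {a c d t : ℕ}
    (h : 3 ^ a + 2 ^ (d + 2 * t) = 3 ^ c + 2 ^ d)
    (hlt : 2 ^ d < 3 ^ a) (hac : a < c) (hd : d ≠ 0) (ht : t ≠ 0) :
    3 ^ a + 2 ^ (d + 2 * t) = 11 := by
  have ha : a ≠ 0 := by
    rintro rfl
    exact absurd hlt (by simp)
  have hc : 2 ^ t ≤ c := Nat.le_of_dvd (by omega) (by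
    exact_mod_cast two_pow_dvd_of_pow_add_pow_eq (a := a) (c := c) (d := d) (t := t)
      (by exact_mod_cast h) (by exact_mod_cast hlt) ha (by omega))
  have h1 : 1 ≤ 4 ^ t := Nat.one_le_pow _ _ (by norm_num)
  have h4 : 2 ^ (d + 2 * t) = 2 ^ d * 4 ^ t := by rw [pow_add, pow_mul]; norm_num
  have ha3 : 3 ^ a ≤ 3 * t := by
    refine three_pow_le_of_dvd ht ?_
    refine (Nat.Coprime.pow a d (by norm_num : Nat.Coprime 3 2)).dvd_of_dvd_mul_left ?_
    have : 2 ^ d * (4 ^ t - 1) = 3 ^ c - 3 ^ a := by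
      rw [Nat.mul_sub, mul_one, ← h4]; omega
    rw [this]
    exact Nat.dvd_sub (pow_dvd_pow 3 hac.le) dvd_rfl
  have hlt3 : t < 3 := by
    by_contra! ht3
    have h2 : 2 * t + 2 ≤ 2 ^ t := by
      clear * - ht3
      induction t, ht3 using Nat.le_induction with
      | base => norm_num
      | succ n hn ih => rw [pow_succ]; omega
    have h3 : 3 ^ (2 * t + 2) ≤ 3 ^ c := Nat.pow_le_pow_right (by norm_num) (h2.trans hc)
    rw [pow_add, pow_mul] at h3
    have h5 : t * 4 ^ t ≤ 9 ^ t := calc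
      t * 4 ^ t ≤ 2 ^ t * 4 ^ t := Nat.mul_le_mul_right _ Nat.lt_two_pow_self.le
      _ = 8 ^ t := by rw [← mul_pow]; norm_num
      _ ≤ 9 ^ t := Nat.pow_le_pow_left (by norm_num) t
    have h6 : t ≤ t * 4 ^ t := Nat.le_mul_of_pos_right t h1
    have h7 : 2 ^ d * 4 ^ t ≤ 3 * (t * 4 ^ t) :=
      mul_assoc 3 t (4 ^ t) ▸ Nat.mul_le_mul_right _ (hlt.le.trans ha3)
    norm_num at h3
    have h8 : 1 ≤ 9 ^ t := Nat.one_le_pow _ _ (by norm_num)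
    rw [h4] at h
    linarith [Nat.zero_le (2 ^ d)]
  have hd3 : d < 3 := by
    have : 2 ^ d < 2 ^ 3 := by omega
    exact (Nat.pow_lt_pow_iff_right (by norm_num)).1 this
  have ha2 : a < 2 := by
    have : 3 ^ a < 3 ^ 2 := by omega
    exact (Nat.pow_lt_pow_iff_right (by norm_num)).1 this
  obtain rfl : a = 1 := by omega
  obtain rfl : d = 1 := by
    interval_cases d <;> simp_all
  have : t = 1 ∨ t = 2 := by omega
  rcases this with rfl | rfl
  · rfl
  · have : 3 ^ c = 33 := by omega
    have h5 : c < 4 := by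
      have : 3 ^ c < 3 ^ 4 := by omega
      exact (Nat.pow_lt_pow_iff_right (by norm_num)).1 this
    interval_cases c

theorem forall_small_mem :
    ∀ t ∈ Finset.range 10, ∀ d ∈ Finset.range 7, ∀ a ∈ Finset.range 4, ∀ b ∈ Finset.range 40,
    t ≠ 0 → a ≠ 0 →
    3 ^ a + 2 ^ b = 3 ^ (a + 2 * t) + 2 ^ d → 3 ^ a + 2 ^ b ∈ [35, 259] := by
  decide +kernel

theorem mem_of_three_pow_lt_two_pow {a b d t : ℕ} (h : 3 ^ a + 2 ^ b = 3 ^ (a + 2 * t) + 2 ^ d)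
    (hlt : 3 ^ a < 2 ^ d) (hdb : d < b) (ha : a ≠ 0) (ht : t ≠ 0) :
    3 ^ a + 2 ^ b ∈ [35, 259] := by
  have h9 : 3 ^ (a + 2 * t) = 3 ^ a * 9 ^ t := by rw [pow_add, pow_mul]; norm_num
  have h19 : 1 ≤ 9 ^ t := Nat.one_le_pow _ _ (by norm_num)
  have key : 3 ^ a * (9 ^ t - 1) = 2 ^ b - 2 ^ d := by
    rw [Nat.mul_sub, mul_one, ← h9]; omega
  have hd : 2 ^ d ≤ 8 * t := by
    refine two_pow_le_of_dvd ht ?_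
    refine (Nat.Coprime.pow d a (by norm_num : Nat.Coprime 2 3)).dvd_of_dvd_mul_left ?_
    rw [key]
    exact Nat.dvd_sub (pow_dvd_pow 2 hdb.le) dvd_rfl
  have hd3 : 3 ≤ d := by
    by_contra! hd3
    have h8 : 8 ∣ 3 ^ a * (9 ^ t - 1) := by
      have : 9 - 1 ∣ 9 ^ t - 1 := by simpa using Nat.sub_dvd_pow_sub_pow 9 1 t
      exact this.mul_left _
    have h3a : 3 ^ 1 ≤ 3 ^ a := Nat.pow_le_pow_right (by norm_num) (by omega)
    have h3 : d = 2 := by interval_cases d <;> omega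
    subst h3
    rw [key] at h8
    have : 2 ^ 3 ∣ 2 ^ b := pow_dvd_pow 2 (by omega)
    omega
  obtain ⟨m, rfl⟩ : ∃ m, d = m + 2 := ⟨d - 2, by omega⟩
  obtain ⟨n, rfl⟩ : ∃ n, b = n + 2 := ⟨b - 2, by omega⟩
  obtain ⟨a, rfl⟩ := Nat.exists_eq_add_one_of_ne_zero ha
  have hdvd := three_pow_dvd_of_pow_add_pow_eq (a := a) (m := m) (n := n) (t := t)
    (by exact_mod_cast h) (by exact_mod_cast hlt) (by omega) (by omega)
  have h3t : (3 : ℤ) ^ t ≤ n * 4 ^ m := by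
    set x : ℤ := 3 ^ a * (3 ^ (a + 1) - 2 ^ (m + 2)) + 4 ^ m with hx
    have h42 : (4 : ℤ) ^ m = 2 ^ m * 2 ^ m := by rw [← mul_pow]; norm_num
    have hxo : Odd x := by
      have h3 (k : ℕ) : Odd ((3 : ℤ) ^ k) := Odd.pow (by decide)
      exact ((h3 a).mul ((h3 _).sub_even (even_two.pow_of_ne_zero (by omega)))).add_even
        (Even.pow_of_ne_zero (by decide) (by omega))
    have hx0 : x ≠ 0 := by rintro h0; rw [h0] at hxo; exact absurd hxo (by decide)
    have hn0 : (n : ℤ) ≠ 0 := by exact_mod_cast (by omega : n ≠ 0)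
    have hle : |x| ≤ 4 ^ m := by
      have hlt' : (3 : ℤ) ^ (a + 1) < 2 ^ (m + 2) := by exact_mod_cast hlt
      rw [abs_le]
      constructor
      · rw [hx, h42, pow_succ, pow_add]
        nlinarith [sq_nonneg (3 * 3 ^ a - 2 * 2 ^ m : ℤ), sq_nonneg ((2 : ℤ) ^ m)]
      · have : (3 : ℤ) ^ a * (3 ^ (a + 1) - 2 ^ (m + 2)) ≤ 0 :=
          mul_nonpos_of_nonneg_of_nonpos (by positivity) (by linarith)
        linarith
    calc (3 : ℤ) ^ t ≤ |n * x| := Int.le_of_dvd (abs_pos.2 (mul_ne_zero hn0 hx0))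
          ((dvd_abs _ _).2 hdvd)
      _ = n * |x| := by rw [abs_mul, Nat.abs_cast]
      _ ≤ n * 4 ^ m := mul_le_mul_of_nonneg_left hle (by positivity)
  have hm : 4 ^ m ≤ 4 * t ^ 2 := by
    have h42 : 4 ^ m = 2 ^ m * 2 ^ m := by rw [← mul_pow]; norm_num
    have : 2 ^ m ≤ 2 * t := by rw [pow_add] at hd; omega
    calc 4 ^ m = 2 ^ m * 2 ^ m := h42
      _ ≤ 2 * t * (2 * t) := Nat.mul_le_mul this this
      _ = 4 * t ^ 2 := by ring
  have h3t : 3 ^ t ≤ n * (4 * t ^ 2) := le_trans (by exact_mod_cast h3t) (Nat.mul_le_mul_left n hm)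
  have hn : 2 ^ (n + 2) ≤ 8 * t * (9 ^ t + 1) := by nlinarith
  have ht9 : t < 10 := by
    by_contra! ht
    have h₁ : 2 * t * (9 ^ t + 1) ≤ 16 ^ t := by
      clear * - ht
      induction t, ht using Nat.le_induction with
      | base => norm_num
      | succ k hk ih => rw [pow_succ, pow_succ]; nlinarith [Nat.one_le_pow k 9 (by norm_num)]
    have h₂ : 16 * t ^ 3 < 3 ^ t := by
      clear * - ht
      induction t, ht using Nat.le_induction with
      | base => norm_num
      | succ k hk ih =>
        have : (k + 1) ^ 3 ≤ 3 * k ^ 3 := by nlinarith [Nat.mul_le_mul_right (k ^ 2) hk]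
        rw [pow_succ 3]
        omega
    have h₃ : n ≤ 4 * t := by
      refine (Nat.pow_le_pow_iff_right (a := 2) (by norm_num)).1 ?_
      rw [pow_mul, show 2 ^ 4 = 16 from rfl]
      rw [pow_add] at hn
      linarith
    nlinarith
  have hd7 : m + 2 < 7 :=
    (Nat.pow_lt_pow_iff_right (a := 2) (by norm_num)).1 (by omega : _ < 2 ^ 7)
  have ha4 : a + 1 < 4 :=
    (Nat.pow_lt_pow_iff_right (a := 3) (by norm_num)).1 (by omega : _ < 3 ^ 4)
  have hb40 : n + 2 < 40 := by
    refine (Nat.pow_lt_pow_iff_right (a := 2) (by norm_num)).1 (hn.trans_lt ?_)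
    interval_cases t <;> norm_num
  exact forall_small_mem t (Finset.mem_range.2 ht9) _ (Finset.mem_range.2 hd7) _
    (Finset.mem_range.2 ha4) _ (Finset.mem_range.2 hb40) ht ha h

theorem even_of_pow_add_pow_eq {c d b : ℕ} (hc : c ≠ 0) (h : 1 + 2 ^ b = 3 ^ c + 2 ^ d) :
    Even b := by
  by_contra hb
  have h2 (n : ℕ) : 2 ^ n % 3 = if Even n then 1 else 2 := by
    induction n with
    | zero => rfl
    | succ n ih => rw [pow_succ, Nat.mul_mod, ih]; by_cases h : Even n <;> simp [h, Nat.even_add_one]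
  have hb3 := h2 b
  rw [if_neg hb] at hb3
  have hd3 := h2 d
  have h3 : 3 ∣ 3 ^ c := dvd_pow_self 3 hc
  split_ifs at hd3 <;> omega

theorem three_pow_mod_eight (n : ℕ) : 3 ^ n % 8 = if Even n then 1 else 3 := by
  induction n with
  | zero => rfl
  | succ n ih => rw [pow_succ, Nat.mul_mod, ih]; by_cases h : Even n <;> simp [h, Nat.even_add_one]

theorem eq_seventeen_of_one_add_two_pow_eq {b d t : ℕ}
    (h : 1 + 2 ^ b = 3 ^ (2 * t) + 2 ^ d) (hdb : d < b) (ht : t ≠ 0) :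
    1 + 2 ^ b = 17 := by
  obtain ⟨e, rfl⟩ := even_of_pow_add_pow_eq (by omega) h
  have h9 : 3 ^ (2 * t) = 9 ^ t := by rw [pow_mul]; norm_num
  have hd : 2 ^ d ≤ 8 * t := by
    refine two_pow_le_of_dvd ht ?_
    rw [show 9 ^ t - 1 = 2 ^ (e + e) - 2 ^ d by omega]
    exact Nat.dvd_sub (pow_dvd_pow 2 hdb.le) dvd_rfl
  have h99 : 9 ^ t = 3 ^ t * 3 ^ t := by rw [← mul_pow]; norm_num
  have hlt : 3 ^ t < 2 ^ e := by
    by_contra! hle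
    have := Nat.mul_le_mul hle hle
    have : 2 ^ d ≥ 2 := by
      have h9o : 9 ^ t % 2 = 1 := by rw [Nat.pow_mod]; simp
      have hbe : 2 ∣ 2 ^ (e + e) := dvd_pow_self 2 (by omega)
      have := Nat.one_le_two_pow (n := d)
      omega
    rw [h9, h99, pow_add] at h
    omega
  have hbound : 2 * 3 ^ t < 8 * t := by
    have h₁ : (3 ^ t + 1) * (3 ^ t + 1) ≤ 2 ^ e * 2 ^ e := Nat.mul_le_mul hlt hlt
    rw [h9, h99, pow_add] at h
    nlinarith
  have ht1 : t < 2 := by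
    by_contra! ht
    have : 4 * t < 3 ^ t := by
      clear * - ht
      induction t, ht using Nat.le_induction with
      | base => norm_num
      | succ k hk ih => rw [pow_succ]; omega
    omega
  obtain rfl : t = 1 := by omega
  have hd4 : d < 4 := (Nat.pow_lt_pow_iff_right (a := 2) (by norm_num)).1 (by omega)
  have he : e < 3 := by
    refine (Nat.pow_lt_pow_iff_right (a := 2) (by norm_num)).1 ?_
    rw [pow_add] at h
    nlinarith
  interval_cases d <;> interval_cases e <;> simp_all

/-- Two representations with `a < c` give one of the five listed values. -/
theorem mem_of_two_representations {a b c d : ℕ} (h : 3 ^ a + 2 ^ b = 3 ^ c + 2 ^ d) (hac : a < c) :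
    3 ^ a + 2 ^ b ∈ [5, 11, 17, 35, 259] := by
  have hlt : 3 ^ a < 3 ^ c := Nat.pow_lt_pow_right (by norm_num) hac
  have hdb : d < b := (Nat.pow_lt_pow_iff_right (a := 2) (by norm_num)).1 (by omega)
  have h3o (n : ℕ) : 3 ^ n % 2 = 1 := by rw [Nat.pow_mod]; simp
  have hb2 : 2 ∣ 2 ^ b := dvd_pow_self 2 (by omega)
  have hd : d ≠ 0 := by
    rintro rfl
    have := h3o a
    have := h3o c
    omega
  have hd2 : 2 ∣ 2 ^ d := dvd_pow_self 2 hd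
  have ha2 := h3o a
  rcases lt_or_gt_of_ne (show 3 ^ a ≠ 2 ^ d by omega) with hK | hK
  · obtain ⟨x, rfl⟩ := Nat.exists_eq_add_of_lt hac
    obtain ⟨t, ht | ht⟩ := Nat.even_or_odd' (x + 1)
    · rw [add_assoc, ht] at h
      rcases Nat.eq_zero_or_pos a with rfl | ha
      · rw [pow_zero, zero_add] at h
        simp [eq_seventeen_of_one_add_two_pow_eq h hdb (by omega)]
      · have := mem_of_three_pow_lt_two_pow h hK hdb (by omega) (by omega)
        simp only [List.mem_cons, List.not_mem_nil, or_false] at this ⊢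
        tauto
    · have hp : Even a ↔ ¬ Even (a + x + 1) := by
        rw [add_assoc, Nat.even_add]
        have : ¬ Even (x + 1) := by rw [Nat.not_even_iff_odd]; exact ⟨t, ht⟩
        tauto
      have h₁ := three_pow_mod_eight a
      have h₂ := three_pow_mod_eight (a + x + 1)
      have h4 : 2 ^ 2 ∣ 2 ^ b := pow_dvd_pow 2 (by omega)
      have hd1 : d = 1 := by
        by_contra hd1
        have : 2 ^ 2 ∣ 2 ^ d := pow_dvd_pow 2 (by omega)
        by_cases he : Even a
        · rw [if_pos he] at h₁; rw [if_neg (hp.1 he)] at h₂; omega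
        · rw [if_neg he] at h₁; rw [if_pos (by tauto)] at h₂; omega
      subst hd1
      have ha : a = 0 := by
        by_contra ha
        have : 3 ^ 1 ≤ 3 ^ a := Nat.pow_le_pow_right (by norm_num) (by omega)
        omega
      subst ha
      rw [if_neg (hp.1 (by simp))] at h₂
      have hb3 : b < 3 := by
        by_contra! hb
        have : 2 ^ 3 ∣ 2 ^ b := pow_dvd_pow 2 hb
        omega
      obtain rfl : b = 2 := by omega
      simp
  · obtain ⟨y, rfl⟩ := Nat.exists_eq_add_of_lt hdb
    obtain ⟨t, ht | ht⟩ := Nat.even_or_odd' (y + 1)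
    · rw [add_assoc, ht] at h ⊢
      simp [eq_eleven_of_two_pow_lt_three_pow h hK hac hd (by omega)]
    · exfalso
      have ha : a ≠ 0 := by
        rintro rfl
        exact absurd hK (by simp)
      have h3a : 3 ∣ 3 ^ a := dvd_pow_self 3 ha
      have h3c : 3 ∣ 3 ^ c := dvd_pow_self 3 (by omega)
      have h4 : 4 ^ t % 3 = 1 := by rw [Nat.pow_mod]; simp
      have h2d : ¬ 3 ∣ 2 ^ d := fun h' => absurd (Nat.prime_three.dvd_of_dvd_pow h') (by norm_num)
      have hm : 2 ^ (d + y + 1) % 3 = 2 ^ d * 2 % 3 := by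
        rw [add_assoc, ht, pow_add, pow_succ, pow_mul, ← mul_assoc, mul_right_comm, Nat.mul_mod,
          show 2 ^ 2 = 4 from rfl, h4, mul_one, Nat.mod_mod]
      omega

/-- A positive integer `N` admits at least two distinct ordered pairs `(a, b)`
of nonnegative integers with `N = 3^a + 2^b` if and only if
`N ∈ {5, 11, 17, 35, 259}`. -/
theorem two_representations_iff (N : ℕ) (hN : 0 < N) :
    (∃ p q : ℕ × ℕ, p ≠ q ∧ N = 3 ^ p.1 + 2 ^ p.2 ∧ N = 3 ^ q.1 + 2 ^ q.2) ↔
      N ∈ ({5, 11, 17, 35, 259} : Set ℕ) := by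
  constructor
  · rintro ⟨⟨a, b⟩, ⟨c, d⟩, hne, h₁, h₂⟩
    suffices N ∈ [5, 11, 17, 35, 259] by simpa using this
    dsimp only at h₁ h₂
    rcases lt_trichotomy a c with hac | rfl | hac
    · rw [h₁]
      exact mem_of_two_representations (h₁.symm.trans h₂) hac
    · have : b = d := Nat.pow_right_injective le_rfl (by simp only; omega)
      exact absurd (by rw [this]) hne
    · rw [h₂]
      exact mem_of_two_representations (h₂.symm.trans h₁) hac
  · rintro (rfl | rfl | rfl | rfl | rfl)
    · exact ⟨(0, 2), (1, 1), by decide, rfl, rfl⟩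
    · exact ⟨(1, 3), (2, 1), by decide, rfl, rfl⟩
    · exact ⟨(0, 4), (2, 3), by decide, rfl, rfl⟩
    · exact ⟨(1, 5), (3, 3), by decide, rfl, rfl⟩
    · exact ⟨(1, 8), (5, 4), by decide, rfl, rfl⟩
end

section
/- There do not exist positive integers a and d with a + 6d < 3^9 = 19683 such that a + i·d ∈ S for every i ∈ {0, 1, 2, 3, 4, 5, 6}; that is, every seven-term arithmetic progression contained in S (if one existed) would have largest term at least 3^9. -/
/-- The sums `3 ^ x + 2 ^ y` with `x < 9` and `y < 15`. -/
def smallSums : List ℕ :=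
  (List.range 9).flatMap fun x => (List.range 15).map fun y => 3 ^ x + 2 ^ y

/-- A bit mask whose bits at the members of `smallSums` are set. -/
def smallSumsMask : ℕ :=
  smallSums.foldl (fun m s => m ||| 1 <<< s) 0

theorem mem_smallSums {x y : ℕ} (h : 3 ^ x + 2 ^ y < 3 ^ 9) : 3 ^ x + 2 ^ y ∈ smallSums := by
  have hx : x < 9 := (Nat.pow_lt_pow_iff_right (by norm_num)).1 ((Nat.le_add_right _ _).trans_lt h)
  have hy : y < 15 := (Nat.pow_lt_pow_iff_right (by norm_num)).1
    (((Nat.le_add_left _ _).trans_lt h).trans (by norm_num : 3 ^ 9 < 2 ^ 15))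
  simp only [smallSums, List.mem_flatMap, List.mem_map, List.mem_range]
  exact ⟨x, hx, y, hy, rfl⟩

theorem testBit_smallSumsMask : ∀ s ∈ smallSums, smallSumsMask.testBit s = true := by
  decide +kernel

theorem smallSums_no_seven_term_ap :
    (smallSums.all fun u => smallSums.all fun v =>
      !(Nat.blt u v && (smallSumsMask.testBit (2 * v - u) &&
        (smallSumsMask.testBit (3 * v - 2 * u) && (smallSumsMask.testBit (4 * v - 3 * u) &&
        (smallSumsMask.testBit (5 * v - 4 * u) && smallSumsMask.testBit (6 * v - 5 * u))))))) =
      true := by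
  decide +kernel

/-- There is no seven-term arithmetic progression with positive common
difference contained in `S = {3^x + 2^y}` whose largest term is below
`3^9 = 19683`. -/
theorem no_small_seven_term_ap_in_S :
    ¬ ∃ a d : ℕ, 0 < a ∧ 0 < d ∧ a + 6 * d < 3 ^ 9 ∧
      ∀ i : ℕ, i ≤ 6 → ∃ x y : ℕ, a + i * d = 3 ^ x + 2 ^ y := by
  rintro ⟨a, d, -, hd, hlt, h⟩
  have mem (i : ℕ) (hi : i ≤ 6) : a + i * d ∈ smallSums := by
    obtain ⟨x, y, hxy⟩ := h i hi
    have : i * d ≤ 6 * d := Nat.mul_le_mul_right d hi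
    rw [hxy]
    exact mem_smallSums (by omega)
  have bit (i : ℕ) (hi : i ≤ 6) {n : ℕ} (hn : n = a + i * d) :
      smallSumsMask.testBit n = true :=
    hn ▸ testBit_smallSumsMask _ (mem i hi)
  have key := List.all_eq_true.1 (List.all_eq_true.1 smallSums_no_seven_term_ap _
    (mem 0 (by omega))) _ (mem 1 (by omega))
  rw [bit 2 (by omega) (by omega), bit 3 (by omega) (by omega), bit 4 (by omega) (by omega),
    bit 5 (by omega) (by omega), bit 6 (by omega) (by omega)] at key
  have hblt : Nat.blt (a + 0 * d) (a + 1 * d) = true := by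
    simpa [Nat.blt_eq] using hd
  rw [hblt] at key
  exact absurd key (by decide)
end

section
/- Under the standing hypotheses, every representation of a + 3d as a sum of a power of 3 and a power of 2 has large exponents: if a + 3d = 3^x + 2^y with x, y nonnegative integers, then x ≥ m - 1 or y ≥ n - 1. Hence a + 3d can only be written in one of the four forms 3^m + 2^y, 3^{m-1} + 2^y, 3^x + 2^{n-1}, 3^x + 2^n. -/
/-- Under the standing hypotheses, every representation a + 3d = 3^x + 2^y has x ≥ m - 1 or y ≥ n - 1. -/
theorem a4_large_exponents (a d m n : ℕ)
    (ha : 0 < a) (hd : 0 < d)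
    (hAP : ∀ i : ℕ, i ≤ 6 → ∃ x y : ℕ, a + i * d = 3 ^ x + 2 ^ y)
    (hbig : 3 ^ 9 ≤ a + 6 * d)
    (hm₁ : 3 ^ m ≤ a + 6 * d) (hm₂ : a + 6 * d < 3 ^ (m + 1))
    (hn₁ : 2 ^ n ≤ a + 6 * d) (hn₂ : a + 6 * d < 2 ^ (n + 1)) :
    ∀ x y : ℕ, a + 3 * d = 3 ^ x + 2 ^ y → m - 1 ≤ x ∨ n - 1 ≤ y := by
  intro x y h
  by_contra! hlt
  have hx : 3 ^ (x + 2) ≤ 3 ^ m := Nat.pow_le_pow_right (by norm_num) (by omega)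
  have hy : 2 ^ (y + 2) ≤ 2 ^ n := Nat.pow_le_pow_right (by norm_num) (by omega)
  rw [pow_add] at hx hy
  omega
end

section
/- Under the standing hypotheses, every representation of a + 6d as 3^x + 2^y with x, y nonnegative integers has x = m or y = n, and likewise every representation of a + 5d as 3^x + 2^y has x = m or y = n. -/
/-- If `3 ^ x + 2 ^ y` is at most `N` but exceeds `5 * N / 6`, then `x` or `y` is the largest
exponent whose power is at most `N`. -/
theorem top_exponent_of_five_mul_lt {N m n x y : ℕ}
    (hm₁ : 3 ^ m ≤ N) (hm₂ : N < 3 ^ (m + 1)) (hn₁ : 2 ^ n ≤ N) (hn₂ : N < 2 ^ (n + 1))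
    (hle : 3 ^ x + 2 ^ y ≤ N) (hlt : 5 * N < 6 * (3 ^ x + 2 ^ y)) : x = m ∨ y = n := by
  by_contra! h
  have hx₀ : 0 < 3 ^ x := by positivity
  have hy₀ : 0 < 2 ^ y := by positivity
  have hx : x < m + 1 := (Nat.pow_lt_pow_iff_right (by norm_num : 1 < 3)).1 (by omega)
  have hy : y < n + 1 := (Nat.pow_lt_pow_iff_right (by norm_num : 1 < 2)).1 (by omega)
  have hxm : 3 ^ (x + 1) ≤ 3 ^ m := Nat.pow_le_pow_right (by norm_num) (by omega)
  have hyn : 2 ^ (y + 1) ≤ 2 ^ n := Nat.pow_le_pow_right (by norm_num) (by omega)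
  rw [pow_succ] at hxm hyn
  omega


/-- Under the standing hypotheses, every representation of a + 6d (resp. a + 5d) as 3^x + 2^y has x = m or y = n. -/
theorem a1_a2_top_exponents (a d m n : ℕ)
    (ha : 0 < a) (hd : 0 < d)
    (hAP : ∀ i : ℕ, i ≤ 6 → ∃ x y : ℕ, a + i * d = 3 ^ x + 2 ^ y)
    (hbig : 3 ^ 9 ≤ a + 6 * d)
    (hm₁ : 3 ^ m ≤ a + 6 * d) (hm₂ : a + 6 * d < 3 ^ (m + 1))
    (hn₁ : 2 ^ n ≤ a + 6 * d) (hn₂ : a + 6 * d < 2 ^ (n + 1)) :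
    (∀ x y : ℕ, a + 6 * d = 3 ^ x + 2 ^ y → x = m ∨ y = n) ∧
      (∀ x y : ℕ, a + 5 * d = 3 ^ x + 2 ^ y → x = m ∨ y = n) := by
  exact ⟨fun x y h => top_exponent_of_five_mul_lt hm₁ hm₂ hn₁ hn₂ (by omega) (by omega),
    fun x y h => top_exponent_of_five_mul_lt hm₁ hm₂ hn₁ hn₂ (by omega) (by omega)⟩
end

section
/- Under the standing hypotheses, every representation of a + 4d as 3^x + 2^y with x, y nonnegative integers satisfies x = m, or y = n, or (x = m - 1 and y = n - 1); that is, a + 4d can only be written as 3^m + 2^y, or 3^x + 2^n, or 3^{m-1} + 2^{n-1}. -/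
/-- Under the standing hypotheses, every representation a + 4d = 3^x + 2^y has x = m, or y = n, or (x = m - 1 and y = n - 1). -/
theorem a3_possible_forms (a d m n : ℕ)
    (ha : 0 < a) (hd : 0 < d)
    (hAP : ∀ i : ℕ, i ≤ 6 → ∃ x y : ℕ, a + i * d = 3 ^ x + 2 ^ y)
    (hbig : 3 ^ 9 ≤ a + 6 * d)
    (hm₁ : 3 ^ m ≤ a + 6 * d) (hm₂ : a + 6 * d < 3 ^ (m + 1))
    (hn₁ : 2 ^ n ≤ a + 6 * d) (hn₂ : a + 6 * d < 2 ^ (n + 1)) :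
    ∀ x y : ℕ, a + 4 * d = 3 ^ x + 2 ^ y → x = m ∨ y = n ∨ (x = m - 1 ∧ y = n - 1) := by
  intro x y h
  have hx0 : 0 < 3 ^ x := by positivity
  have hy0 : 0 < 2 ^ y := by positivity
  have hx : x < m + 1 := (Nat.pow_lt_pow_iff_right (a := 3) (by norm_num)).1 (by omega)
  have hy : y < n + 1 := (Nat.pow_lt_pow_iff_right (a := 2) (by norm_num)).1 (by omega)
  by_contra! hne
  obtain ⟨hxm, hyn, hxy⟩ := hne
  have h3 : 3 ^ (x + 1) ≤ 3 ^ m := Nat.pow_le_pow_right (by norm_num) (by omega)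
  have h2 : 2 ^ (y + 1) ≤ 2 ^ n := Nat.pow_le_pow_right (by norm_num) (by omega)
  rcases Nat.lt_or_ge (x + 1) m with hlt | hge
  · have h9 : 3 ^ (x + 2) ≤ 3 ^ m := Nat.pow_le_pow_right (by norm_num) hlt
    rw [pow_add] at h9 h2
    omega
  · have hy2 : y + 2 ≤ n := by
      have := hxy (by omega)
      omega
    have h4 : 2 ^ (y + 2) ≤ 2 ^ n := Nat.pow_le_pow_right (by norm_num) hy2
    rw [pow_add] at h4 h3
    omega
end
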